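/- There exists c > 0 such that for every integer n ≥ 0 and every k ∈ ℂ with k ≠ 0 and |Im k| < c, one has B̃_n(k) ≠ 0. (Equivalently, the horizontal strip {k ∈ ℂ : |Im k| < c} contains no Born transmission eigenvalue in dimension d = 3.) -/

import Mathlib

open MeasureTheory intervalIntegral Complex

/-- Spherical Bessel function of the first kind of integer order `n`:
`j_n(z) = ∑_{m=0}^∞ ((−1)^m / (2^m m! (2n+2m+1)!!)) z^{2m+n}`. -/
noncomputable def sphBesselJ (n : ℕ) (z : ℂ) : ℂ :=
  ∑' m : ℕ, ((-1) ^ m /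
      ((2 ^ m * Nat.factorial m * Nat.doubleFactorial (2 * n + 2 * m + 1) : ℕ) : ℂ)) *
    z ^ (2 * m + n)

/-- `B̃_n(k) = ∫_0^1 (t+1)^2 j_n(kt)^2 dt`. -/
noncomputable def BornB3 (n : ℕ) (k : ℂ) : ℂ :=
  ∫ t in (0:ℝ)..1, ((t : ℂ) + 1) ^ 2 * (sphBesselJ n (k * t)) ^ 2

/-- real coefficients of the even entire part of the spherical Bessel function -/
noncomputable def cf (n m : ℕ) : ℝ :=
  (-1) ^ m / ((2 ^ m * Nat.factorial m * Nat.doubleFactorial (2 * n + 2 * m + 1) : ℕ) : ℝ)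

lemma cf_abs_le (n m : ℕ) : |cf n m| ≤ 1 / (Nat.factorial m : ℝ) := by
  unfold cf
  rw [abs_div, abs_pow, abs_neg, abs_one, one_pow, Nat.abs_cast]
  apply one_div_le_one_div_of_le (by positivity)
  norm_cast
  have h1 : 1 ≤ 2 ^ m := Nat.one_le_two_pow
  have h2 : 1 ≤ Nat.doubleFactorial (2 * n + 2 * m + 1) := Nat.doubleFactorial_pos _
  calc m.factorial = 1 * m.factorial * 1 := by ring
    _ ≤ _ := by gcongr

lemma cf_succ (n m : ℕ) : cf n (m + 1) * (m + 1) = -(1 / 2) * cf (n + 1) m := by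
  unfold cf
  have e : 2 * n + 2 * (m + 1) + 1 = 2 * (n + 1) + 2 * m + 1 := by ring
  rw [e, Nat.factorial_succ]
  have h2 : (Nat.doubleFactorial (2 * (n + 1) + 2 * m + 1) : ℝ) ≠ 0 := by
    exact_mod_cast (Nat.doubleFactorial_pos _).ne'
  have h3 : (Nat.factorial m : ℝ) ≠ 0 := by positivity
  push_cast
  field_simp
  ring

lemma cf_rec (n m : ℕ) : cf n (m + 1) = (2 * n + 3) * cf (n + 1) (m + 1) - cf (n + 2) m := by
  unfold cf
  have e : 2 * (n + 1) + 2 * (m + 1) + 1 = (2 * n + 2 * (m + 1) + 1) + 2 := by ring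
  have e' : 2 * (n + 2) + 2 * m + 1 = (2 * n + 2 * (m + 1) + 1) + 2 := by ring
  rw [e, e', Nat.factorial_succ, Nat.doubleFactorial_add_two]
  have h2 : (Nat.doubleFactorial (2 * n + 2 * (m + 1) + 1) : ℝ) ≠ 0 := by
    exact_mod_cast (Nat.doubleFactorial_pos _).ne'
  have h3 : (Nat.factorial m : ℝ) ≠ 0 := by positivity
  have h4 : (2 * (n : ℝ) + 2 * (m + 1) + 1 + 2) ≠ 0 := by positivity
  push_cast
  field_simp
  ring

lemma cf_rec0 (n : ℕ) : cf n 0 = (2 * n + 3) * cf (n + 1) 0 := by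
  unfold cf
  have e : 2 * (n + 1) + 2 * 0 + 1 = (2 * n + 2 * 0 + 1) + 2 := by ring
  rw [e, Nat.doubleFactorial_add_two]
  have h2 : (Nat.doubleFactorial (2 * n + 2 * 0 + 1) : ℝ) ≠ 0 := by
    exact_mod_cast (Nat.doubleFactorial_pos _).ne'
  have h4 : (2 * (n : ℝ) + 2 * 0 + 1 + 2) ≠ 0 := by positivity
  push_cast
  field_simp
  ring

lemma cf_zero_pos (n : ℕ) : 0 < cf n 0 := by
  unfold cf
  have : 0 < Nat.doubleFactorial (2 * n + 2 * 0 + 1) := Nat.doubleFactorial_pos _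
  have h : 0 < 2 ^ 0 * Nat.factorial 0 * Nat.doubleFactorial (2 * n + 2 * 0 + 1) := by positivity
  rw [pow_zero]
  exact div_pos one_pos (by exact_mod_cast h)

/-- `j_n(z) = z^n * HC n (z^2)` -/
noncomputable def HC (n : ℕ) (q : ℂ) : ℂ := ∑' m : ℕ, (cf n m : ℂ) * q ^ m

lemma term_norm_le (n m : ℕ) (q : ℂ) (R : ℝ) (hq : ‖q‖ ≤ R) :
    ‖(cf n m : ℂ) * q ^ m‖ ≤ R ^ m / (Nat.factorial m : ℝ) := by
  rw [norm_mul, norm_pow, Complex.norm_real, Real.norm_eq_abs]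
  calc |cf n m| * ‖q‖ ^ m ≤ 1 / (Nat.factorial m : ℝ) * R ^ m := by
        gcongr
        exact cf_abs_le n m
    _ = _ := by ring

lemma summable_HC (n : ℕ) (q : ℂ) : Summable fun m : ℕ => (cf n m : ℂ) * q ^ m :=
  Summable.of_norm_bounded (Real.summable_pow_div_factorial ‖q‖)
    fun m => term_norm_le n m q _ le_rfl

lemma HC_norm_le (n : ℕ) (q : ℂ) : ‖HC n q‖ ≤ Real.exp ‖q‖ := by
  rw [Real.exp_eq_exp_ℝ, NormedSpace.exp_eq_tsum_div]
  exact tsum_of_norm_bounded (Real.summable_pow_div_factorial ‖q‖).hasSum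
    fun m => term_norm_le n m q _ le_rfl

lemma hasDerivAt_HC (n : ℕ) (q : ℂ) : HasDerivAt (HC n) (-(1 / 2) * HC (n + 1) q) q := by
  set R := ‖q‖ + 1 with hR
  have hmem : q ∈ Metric.ball (0 : ℂ) R := by simp [hR]
  have hd : ∀ i : ℕ, DifferentiableOn ℂ (fun w : ℂ => (cf n i : ℂ) * w ^ i)
      (Metric.ball (0 : ℂ) R) := fun i => by fun_prop
  have hb : ∀ (i : ℕ) (w : ℂ), w ∈ Metric.ball (0 : ℂ) R →
      ‖(cf n i : ℂ) * w ^ i‖ ≤ R ^ i / (Nat.factorial i : ℝ) := fun i w hw =>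
    term_norm_le n i w R (by simpa using (mem_ball_zero_iff.1 hw).le)
  have hs := Real.summable_pow_div_factorial R
  have key := Complex.hasSum_deriv_of_summable_norm hs hd Metric.isOpen_ball hb hmem
  have hdiff := Complex.differentiableOn_tsum_of_summable_norm hs hd Metric.isOpen_ball hb
  have hda : DifferentiableAt ℂ (HC n) q :=
    hdiff.differentiableAt (Metric.isOpen_ball.mem_nhds hmem)
  have hval : deriv (HC n) q = -(1 / 2) * HC (n + 1) q := by
    have h1 : deriv (HC n) q = ∑' i : ℕ, deriv (fun w : ℂ => (cf n i : ℂ) * w ^ i) q :=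
      key.tsum_eq.symm
    rw [h1, key.summable.tsum_eq_zero_add]
    have : ∀ i : ℕ, deriv (fun w : ℂ => (cf n (i + 1) : ℂ) * w ^ (i + 1)) q
        = -(1 / 2) * ((cf (n + 1) i : ℂ) * q ^ i) := by
      intro i
      have := cf_succ n i
      have h : (cf n (i + 1) : ℂ) * (i + 1) = -(1 / 2) * (cf (n + 1) i : ℂ) := by
        have h' := congrArg (fun x : ℝ => (x : ℂ)) this
        push_cast at h'
        exact h'
      simp only [deriv_const_mul_field, deriv_pow_field, Nat.add_sub_cancel]
      push_cast
      linear_combination q ^ i * h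
    simp_rw [this]
    rw [tsum_mul_left]
    simp [HC]
  rw [← hval]
  exact hda.hasDerivAt

lemma HC_rec (n : ℕ) (q : ℂ) : HC n q = (2 * n + 3) * HC (n + 1) q - q * HC (n + 2) q := by
  have h0 : HC n q = (cf n 0 : ℂ) * q ^ 0 + ∑' m : ℕ, (cf n (m + 1) : ℂ) * q ^ (m + 1) :=
    (summable_HC n q).tsum_eq_zero_add
  have h1 : HC (n + 1) q = (cf (n + 1) 0 : ℂ) * q ^ 0
      + ∑' m : ℕ, (cf (n + 1) (m + 1) : ℂ) * q ^ (m + 1) :=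
    (summable_HC (n + 1) q).tsum_eq_zero_add
  have s1 : Summable fun m : ℕ => (cf (n + 1) (m + 1) : ℂ) * q ^ (m + 1) :=
    (summable_nat_add_iff 1).2 (summable_HC (n + 1) q)
  have s2 := summable_HC (n + 2) q
  have e : ∀ m : ℕ, (cf n (m + 1) : ℂ) * q ^ (m + 1)
      = (2 * n + 3) * ((cf (n + 1) (m + 1) : ℂ) * q ^ (m + 1)) - q * ((cf (n + 2) m : ℂ) * q ^ m) := by
    intro m
    rw [cf_rec n m]
    push_cast
    ring
  rw [h0, h1]
  simp_rw [e]
  rw [(s1.mul_left _).tsum_sub (s2.mul_left _), tsum_mul_left, tsum_mul_left, cf_rec0 n]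
  unfold HC
  push_cast
  ring

lemma iteratedDeriv_HC (m n : ℕ) : iteratedDeriv m (HC n) = fun q => (-(1 / 2)) ^ m * HC (n + m) q := by
  induction m with
  | zero => simp
  | succ m ih =>
    rw [iteratedDeriv_succ, ih]
    funext q
    have := ((hasDerivAt_HC (n + m) q).const_mul ((-(1 / 2 : ℂ)) ^ m)).deriv
    rw [this, ← add_assoc]
    ring

lemma HC_taylor (n : ℕ) (q δ : ℂ) :
    HasSum (fun m : ℕ => (-δ / 2) ^ m / (Nat.factorial m : ℂ) * HC (n + m) q) (HC n (q + δ)) := by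
  have hd : Differentiable ℂ (HC n) := fun q => (hasDerivAt_HC n q).differentiableAt
  have := Complex.hasSum_taylorSeries_of_entire hd q (q + δ)
  convert! this using 2 with m
  rw [iteratedDeriv_HC]
  simp only [add_sub_cancel_left, smul_eq_mul]
  rw [show -δ / 2 = (-(1/2)) * δ by ring, mul_pow]
  ring

lemma sphBesselJ_eq (n : ℕ) (z : ℂ) : sphBesselJ n z = z ^ n * HC n (z ^ 2) := by
  unfold sphBesselJ HC
  rw [← tsum_mul_left]
  congr 1
  funext m
  unfold cf
  push_cast
  rw [← pow_mul, pow_add]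
  ring

/-- restriction to the reals -/
noncomputable def HR (n : ℕ) (x : ℝ) : ℝ := (HC n x).re

lemma HR_cast (n : ℕ) (x : ℝ) : ((HR n x : ℝ) : ℂ) = HC n x := by
  have : HC n x = ((∑' m : ℕ, cf n m * x ^ m : ℝ) : ℂ) := by
    unfold HC
    push_cast
    rfl
  unfold HR
  rw [this, Complex.ofReal_re]

lemma hasDerivAt_HR (n : ℕ) (x : ℝ) : HasDerivAt (HR n) (-(1 / 2) * HR (n + 1) x) x := by
  have := (hasDerivAt_HC n (x : ℂ)).real_of_complex
  refine this.congr_deriv ?_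
  rw [← HR_cast]
  have : (-(1/2 : ℂ)) * (HR (n+1) x : ℂ) = ((-(1/2) * HR (n+1) x : ℝ) : ℂ) := by push_cast; ring
  rw [this, Complex.ofReal_re]

lemma continuous_HR (n : ℕ) : Continuous (HR n) :=
  continuous_iff_continuousAt.2 fun x => (hasDerivAt_HR n x).continuousAt

lemma continuous_HC (n : ℕ) : Continuous (HC n) :=
  continuous_iff_continuousAt.2 fun x => (hasDerivAt_HC n x).continuousAt

lemma HR_rec (n : ℕ) (x : ℝ) : HR n x = (2 * n + 3) * HR (n + 1) x - x * HR (n + 2) x := by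
  have := HC_rec n (x : ℂ)
  rw [← HR_cast, ← HR_cast, ← HR_cast] at this
  exact_mod_cast this

lemma HR_zero_pos (n : ℕ) : 0 < HR n 0 := by
  have : HC n ((0 : ℝ) : ℂ) = (cf n 0 : ℂ) := by
    unfold HC
    rw [tsum_eq_single 0]
    · simp
    · intro m hm
      simp [hm]
  unfold HR
  rw [this, Complex.ofReal_re]
  exact cf_zero_pos n

lemma HR_abs_le (n : ℕ) (x : ℝ) : |HR n x| ≤ Real.exp |x| := by
  have := HC_norm_le n (x : ℂ)
  rwa [← HR_cast, Complex.norm_real, Complex.norm_real] at this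

/-- the spherical Bessel function on the reals -/
noncomputable def ja (n : ℕ) (s : ℝ) : ℝ := s ^ n * HR n (s ^ 2)

/-- `j_{n+1}(s)/s` -/
noncomputable def jr (n : ℕ) (s : ℝ) : ℝ := s ^ n * HR (n + 1) (s ^ 2)

lemma ja_succ (n : ℕ) (s : ℝ) : ja (n + 1) s = s * jr n s := by
  unfold ja jr
  ring

lemma continuous_ja (n : ℕ) : Continuous (ja n) := by
  have := continuous_HR n
  unfold ja
  fun_prop

lemma continuous_jr (n : ℕ) : Continuous (jr n) := by
  have := continuous_HR (n + 1)
  unfold jr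
  fun_prop

lemma hasDerivAt_HRsq (n : ℕ) (s : ℝ) :
    HasDerivAt (fun s => HR n (s ^ 2)) (-(s * HR (n + 1) (s ^ 2))) s := by
  have h := (hasDerivAt_HR n (s ^ 2)).comp s (hasDerivAt_pow 2 s)
  convert! h using 1
  simp
  ring

lemma mul_pow_pred (n : ℕ) (s : ℝ) : s * ((n : ℝ) * s ^ (n - 1)) = n * s ^ n := by
  cases n with
  | zero => simp
  | succ n => simp; ring

lemma hasDerivAt_ja (n : ℕ) (s : ℝ) :
    ∃ α, HasDerivAt (ja n) α s ∧ s * α = n * ja n s - s ^ 2 * jr n s := by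
  refine ⟨_, (hasDerivAt_pow n s).mul (hasDerivAt_HRsq n s), ?_⟩
  unfold ja jr
  linear_combination HR n (s ^ 2) * mul_pow_pred n s

lemma hasDerivAt_jr (n : ℕ) (s : ℝ) :
    ∃ ρ, HasDerivAt (jr n) ρ s ∧ s * ρ = ja n s - (n + 3) * jr n s := by
  refine ⟨_, (hasDerivAt_pow n s).mul (hasDerivAt_HRsq (n + 1) s), ?_⟩
  unfold ja jr
  rw [HR_rec n (s ^ 2)]
  linear_combination HR (n + 1) (s ^ 2) * mul_pow_pred n s

/-- derivative of `j_{n+1}` -/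
lemma hasDerivAt_jb (n : ℕ) (s : ℝ) :
    HasDerivAt (ja (n + 1)) (ja n s - (n + 2) * jr n s) s := by
  obtain ⟨ρ, h, e⟩ := hasDerivAt_jr n s
  have := (hasDerivAt_id s).mul h
  have e2 : ja (n + 1) = fun s => id s * jr n s := by
    funext s
    exact ja_succ n s
  rw [e2]
  convert! this using 1
  simp only [id]
  linear_combination -e

/-- derivative of `j_n j_{n+1}` -/
lemma hasDerivAt_jab (n : ℕ) (s : ℝ) :
    HasDerivAt (fun s => ja n s * ja (n + 1) s)
      (ja n s ^ 2 - ja (n + 1) s ^ 2 - 2 * ja n s * jr n s) s := by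
  obtain ⟨α, h, e⟩ := hasDerivAt_ja n s
  have := h.mul (hasDerivAt_jb n s)
  convert! this using 1
  rw [ja_succ]
  linear_combination -jr n s * e

/-- derivative of `s r²` -/
lemma hasDerivAt_srr (n : ℕ) (s : ℝ) :
    HasDerivAt (fun s => s * jr n s ^ 2)
      (2 * ja n s * jr n s - (2 * n + 5) * jr n s ^ 2) s := by
  obtain ⟨ρ, h, e⟩ := hasDerivAt_jr n s
  have := (hasDerivAt_id s).mul (h.pow 2)
  convert! this using 1
  simp only [id, Pi.pow_apply]
  push_cast
  linear_combination -2 * jr n s * e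

/-- derivative of `s b²` -/
lemma hasDerivAt_sbb (n : ℕ) (s : ℝ) :
    HasDerivAt (fun s => s * ja (n + 1) s ^ 2)
      (2 * s * ja n s * ja (n + 1) s - (2 * n + 3) * ja (n + 1) s ^ 2) s := by
  have := (hasDerivAt_id s).mul ((hasDerivAt_jb n s).pow 2)
  convert! this using 1
  simp only [id, Pi.pow_apply, ja_succ]
  push_cast
  ring

/-- `∫_0^X j_n²` -/
noncomputable def II (n : ℕ) (X : ℝ) : ℝ := ∫ s in (0:ℝ)..X, ja n s ^ 2

lemma ii_sq (n : ℕ) (u v : ℝ) : IntervalIntegrable (fun s => ja n s ^ 2) volume u v :=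
  ((continuous_ja n).pow 2).intervalIntegrable _ _

lemma II_nonneg (n : ℕ) {X : ℝ} (hX : 0 ≤ X) : 0 ≤ II n X :=
  intervalIntegral.integral_nonneg hX fun _ _ => sq_nonneg _

/-- `I_{n+1} ≤ I_n - j_n j_{n+1}(X)` -/
lemma II_le_boundary (n : ℕ) {X : ℝ} (hX : 0 ≤ X) :
    II (n + 1) X ≤ II n X - ja n X * ja (n + 1) X := by
  have ca := continuous_ja n
  have cb := continuous_ja (n + 1)
  have cr := continuous_jr n
  have h1 : ∀ s ∈ Set.uIcc 0 X, HasDerivAt (fun s => ja n s * ja (n + 1) s + s * jr n s ^ 2)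
      (ja n s ^ 2 - ja (n + 1) s ^ 2 - (2 * n + 5) * jr n s ^ 2) s := by
    intro s _
    convert! (hasDerivAt_jab n s).add (hasDerivAt_srr n s) using 1
    ring
  have h2 := intervalIntegral.integral_eq_sub_of_hasDerivAt h1
    (Continuous.intervalIntegrable (by fun_prop) _ _)
  rw [intervalIntegral.integral_sub, intervalIntegral.integral_sub (ii_sq _ _ _) (ii_sq _ _ _)] at h2
  · have h3 : 0 ≤ ∫ s in (0:ℝ)..X, (2 * n + 5) * jr n s ^ 2 :=
      intervalIntegral.integral_nonneg hX fun _ _ => by positivity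
    have h4 : 0 ≤ X * jr n X ^ 2 := by positivity
    have h5 : ja (n + 1) 0 = 0 := by rw [ja_succ]; simp
    rw [h5] at h2
    unfold II
    simp only [mul_zero, zero_mul, add_zero, sub_zero] at h2
    linarith
  · exact Continuous.intervalIntegrable (by fun_prop) _ _
  · exact Continuous.intervalIntegrable (by fun_prop) _ _

lemma II_case1 (n : ℕ) {X : ℝ} (hX : 0 ≤ X) (hXn : X ≤ 2 * n + 3) :
    II (n + 1) X ≤ 4 * II n X := by
  have ca := continuous_ja n
  have cb := continuous_ja (n + 1)
  have h2 := intervalIntegral.integral_eq_sub_of_hasDerivAt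
    (fun s (_ : s ∈ Set.uIcc 0 X) => hasDerivAt_sbb n s)
    (Continuous.intervalIntegrable (by fun_prop) _ _)
  set L : ℝ := 2 * n + 3 with hL
  have hL0 : 0 < L := by positivity
  -- pointwise bound of the derivative
  have h3 : ∫ s in (0:ℝ)..X, (2 * s * ja n s * ja (n + 1) s - L * ja (n + 1) s ^ 2)
      ≤ ∫ s in (0:ℝ)..X, (2 * L * ja n s ^ 2 - L / 2 * ja (n + 1) s ^ 2) := by
    apply intervalIntegral.integral_mono_on hX
      (Continuous.intervalIntegrable (by fun_prop) _ _)
      (Continuous.intervalIntegrable (by fun_prop) _ _)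
    intro s hs
    have hs0 := hs.1
    have hsL : s ≤ L := hs.2.trans hXn
    have h4 : 2 * s * ja n s * ja (n + 1) s ≤ 2 * L * |ja n s * ja (n + 1) s| := by
      calc 2 * s * ja n s * ja (n + 1) s = 2 * s * (ja n s * ja (n + 1) s) := by ring
        _ ≤ 2 * s * |ja n s * ja (n + 1) s| := by gcongr; exact le_abs_self _
        _ ≤ _ := by gcongr
    have h5 : 2 * |ja n s * ja (n + 1) s| ≤ 2 * ja n s ^ 2 + 1 / 2 * ja (n + 1) s ^ 2 := by
      rw [abs_mul, ← sq_abs (ja n s), ← sq_abs (ja (n + 1) s)]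
      nlinarith [sq_nonneg (2 * |ja n s| - |ja (n + 1) s|)]
    nlinarith
  rw [h2, intervalIntegral.integral_sub, intervalIntegral.integral_const_mul,
    intervalIntegral.integral_const_mul] at h3
  · have h4 : 0 ≤ X * ja (n + 1) X ^ 2 := by positivity
    change _ ≤ 2 * L * II n X - L / 2 * II (n + 1) X at h3
    have : 0 ≤ L * (2 * II n X - II (n + 1) X / 2) := by linarith
    have := nonneg_of_mul_nonneg_right this hL0
    linarith
  · exact Continuous.intervalIntegrable (by fun_prop) _ _
  · exact Continuous.intervalIntegrable (by fun_prop) _ _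

lemma window_alg (n a b r s α PP pp σ : ℝ) (hn : 0 ≤ n) (hs : 2 * n + 2 ≤ s) (hbr : b = s * r)
    (e : s * α = n * a - s ^ 2 * r) (hP0 : 0 ≤ PP) (hP16 : PP ≤ 16) (hp0 : 0 ≤ pp) (hp1 : pp ≤ 1)
    (hσ : |σ| ≤ 1) :
    30 * pp ^ 2 * (a ^ 2 + b ^ 2) + PP * (2 * a * α + 2 * b * (a - (n + 2) * r))
      + 60 * (2 * pp * σ * (a * b) + pp ^ 2 * (a ^ 2 - b ^ 2 - 2 * a * r)) ≤ 1000 * a ^ 2 := by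
  have hs0 : 0 < s := by linarith
  have hE : 2 * a * α + 2 * b * (a - (n + 2) * r) ≤ a ^ 2 := by
    have : s * (2 * a * α + 2 * b * (a - (n + 2) * r)) = 2 * n * a ^ 2 - (2 * n + 4) * b ^ 2 := by
      rw [hbr]; linear_combination 2 * a * e
    have h2 : s * (2 * a * α + 2 * b * (a - (n + 2) * r)) ≤ s * a ^ 2 := by
      rw [this]
      have h3 : (2 * n) * a ^ 2 ≤ s * a ^ 2 := by gcongr; linarith
      have h4 : 0 ≤ (2 * n + 4) * b ^ 2 := by positivity
      linarith
    exact le_of_mul_le_mul_left h2 hs0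
  have hPE := mul_le_mul_of_nonneg_left hE hP0
  have hr : |r| ≤ |b| := by
    rw [hbr, abs_mul, abs_of_pos hs0]
    nlinarith [abs_nonneg r]
  have hab : 2 * pp * σ * (a * b) ≤ 2 * (pp * (|a| * |b|)) := by
    have h1 : σ * (a * b) ≤ |a| * |b| := by
      calc _ ≤ |σ * (a * b)| := le_abs_self _
        _ = |σ| * (|a| * |b|) := by rw [abs_mul, abs_mul]
        _ ≤ 1 * (|a| * |b|) := by gcongr
        _ = _ := one_mul _
    have := mul_le_mul_of_nonneg_left h1 hp0
    linarith
  have har : pp ^ 2 * (-(2 * a * r)) ≤ 2 * (pp * (|a| * |b|)) := by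
    have h1 : -(2 * a * r) ≤ 2 * (|a| * |b|) := by
      calc -(2 * a * r) ≤ |-(2 * a * r)| := le_abs_self _
        _ = 2 * (|a| * |r|) := by rw [abs_neg, abs_mul, abs_mul, abs_two]; ring
        _ ≤ _ := by gcongr
    have h0 : 0 ≤ 2 * (|a| * |b|) := by positivity
    have h3 : pp ^ 2 ≤ pp := by nlinarith
    calc pp ^ 2 * (-(2 * a * r)) ≤ pp ^ 2 * (2 * (|a| * |b|)) := by gcongr
      _ ≤ pp * (2 * (|a| * |b|)) := by gcongr
      _ = _ := by ring
  have hAG : 4 * (pp * (|a| * |b|)) ≤ pp ^ 2 * b ^ 2 / 2 + 8 * a ^ 2 := by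
    rw [← sq_abs a, ← sq_abs b]
    nlinarith [sq_nonneg (pp * |b| - 4 * |a|)]
  have hpa : pp ^ 2 * a ^ 2 ≤ a ^ 2 := by
    have : pp ^ 2 ≤ 1 := pow_le_one₀ hp0 hp1
    nlinarith [sq_nonneg a]
  have hPa : PP * a ^ 2 ≤ 16 * a ^ 2 := by gcongr
  have ha0 := sq_nonneg a
  linarith

lemma window (n : ℕ) {X : ℝ} (hXn : 2 * n + 3 ≤ X) :
    ja n X ^ 2 + ja (n + 1) X ^ 2 ≤ 1000 * II n X := by
  have ca := continuous_ja n
  have cb := continuous_ja (n + 1)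
  set u := X - 1 with hu
  have hn : (0 : ℝ) ≤ n := Nat.cast_nonneg n
  have hu2 : 2 * (n : ℝ) + 2 ≤ u := by rw [hu]; linarith
  let P : ℝ → ℝ := fun s => 10 * (s - u) ^ 3 - 15 * (s - u) ^ 4 + 6 * (s - u) ^ 5
  let p : ℝ → ℝ := fun s => (s - u) * (1 - (s - u))
  have cP : Continuous P := by fun_prop
  have cp : Continuous p := by fun_prop
  have hP : ∀ s, HasDerivAt P (30 * p s ^ 2) s := by
    intro s
    have h := (hasDerivAt_id s).sub_const u
    convert! (((h.pow 3).const_mul 10).sub ((h.pow 4).const_mul 15)).add ((h.pow 5).const_mul 6)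
      using 1
    simp only [p, id]
    push_cast
    ring
  have hp : ∀ s, HasDerivAt p (1 - 2 * (s - u)) s := by
    intro s
    have h := (hasDerivAt_id s).sub_const u
    convert! h.mul (h.const_sub 1) using 1
    simp only [id]
    ring
  choose α hα eα using hasDerivAt_ja n
  let φ : ℝ → ℝ := fun s => 30 * p s ^ 2 * (ja n s ^ 2 + ja (n + 1) s ^ 2)
      + P s * (2 * ja n s * α s + 2 * ja (n + 1) s * (ja n s - (n + 2) * jr n s))
      + 60 * (2 * p s * (1 - 2 * (s - u)) * (ja n s * ja (n + 1) s)
        + p s ^ 2 * (ja n s ^ 2 - ja (n + 1) s ^ 2 - 2 * ja n s * jr n s))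
  let Φ : ℝ → ℝ := fun s => P s * (ja n s ^ 2 + ja (n + 1) s ^ 2)
      + 60 * (p s ^ 2 * (ja n s * ja (n + 1) s))
  have hΦ : ∀ s, HasDerivAt Φ (φ s) s := by
    intro s
    have h1 := (hP s).mul (((hα s).pow 2).add ((hasDerivAt_jb n s).pow 2))
    have h2 := (((hp s).pow 2).mul (hasDerivAt_jab n s)).const_mul 60
    refine (h1.add h2).congr_deriv ?_
    simp only [φ, Pi.add_apply, Pi.pow_apply]
    push_cast
    ring
  have hφ : ∀ s ∈ Set.Ioo u X, φ s ≤ 1000 * ja n s ^ 2 := by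
    intro s hs
    have hs1 := hs.1
    have hs2 := hs.2
    set τ := s - u with hτ
    have ht0 : 0 ≤ τ := by rw [hτ]; linarith
    have ht1 : τ ≤ 1 := by rw [hτ, hu]; linarith
    refine window_alg n (ja n s) (ja (n + 1) s) (jr n s) s (α s) (P s) (p s) (1 - 2 * (s - u)) hn
      (by linarith) (ja_succ n s) (eα s) ?_ ?_ ?_ ?_ ?_
    · have hPval : P s = τ ^ 3 * (10 - 15 * τ + 6 * τ ^ 2) := by simp only [P, ← hτ]; ring
      rw [hPval]
      have : 0 ≤ 10 - 15 * τ + 6 * τ ^ 2 := by nlinarith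
      positivity
    · have : τ ^ 3 ≤ 1 := pow_le_one₀ ht0 ht1
      have : τ ^ 5 ≤ 1 := pow_le_one₀ ht0 ht1
      have : 0 ≤ τ ^ 4 := by positivity
      simp only [P, ← hτ]; linarith
    · exact mul_nonneg ht0 (by linarith)
    · simp only [p, ← hτ]; nlinarith
    · rw [← hτ, abs_le]; constructor <;> linarith
  have huX : u ≤ X := by rw [hu]; linarith
  have key := intervalIntegral.sub_le_integral_of_hasDeriv_right_of_le huX
    (g := Φ) (g' := φ) (φ := fun s => 1000 * ja n s ^ 2)
    (by have : Continuous Φ := by fun_prop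
        exact this.continuousOn)
    (fun s _ => (hΦ s).hasDerivWithinAt)
    ((Continuous.continuousOn (by fun_prop)).integrableOn_Icc) hφ
  have e1 : Φ u = 0 := by simp [Φ, P, p]
  have e2 : Φ X = ja n X ^ 2 + ja (n + 1) X ^ 2 := by
    have : X - u = 1 := by rw [hu]; ring
    simp only [Φ, P, p, this]; ring
  rw [e1, e2, intervalIntegral.integral_const_mul, sub_zero] at key
  refine key.trans ?_
  have h0 : 0 ≤ ∫ s in (0:ℝ)..u, ja n s ^ 2 :=
    intervalIntegral.integral_nonneg (by linarith) fun _ _ => sq_nonneg _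
  have h1 := intervalIntegral.integral_add_adjacent_intervals (ii_sq n 0 u) (ii_sq n u X)
  unfold II
  linarith

lemma II_succ_le (n : ℕ) {X : ℝ} (hX : 0 ≤ X) : II (n + 1) X ≤ 501 * II n X := by
  have h0 := II_nonneg n hX
  rcases le_total X (2 * n + 3) with h | h
  · have := II_case1 n hX h
    linarith
  · have h1 := window n h
    have h2 := II_le_boundary n hX
    nlinarith [sq_nonneg (ja n X + ja (n + 1) X)]

lemma II_add_le (n m : ℕ) {X : ℝ} (hX : 0 ≤ X) : II (n + m) X ≤ 501 ^ m * II n X := by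
  induction m with
  | zero => simp
  | succ m ih =>
    have := II_succ_le (n + m) hX
    rw [← add_assoc, pow_succ]
    linarith

/-- scaled Taylor terms -/
noncomputable def tm (n : ℕ) (k : ℂ) (m : ℕ) (t : ℝ) : ℂ :=
  (-(I * (k / ‖k‖)) * k.im * t) ^ m / (Nat.factorial m : ℂ) * (ja (n + m) (‖k‖ * t) : ℂ)

/-- scaled Bessel function at the complex point -/
noncomputable def ZZ (n : ℕ) (k : ℂ) (t : ℝ) : ℂ := ((‖k‖ : ℂ) * t) ^ n * HC n ((k * t) ^ 2)

lemma continuous_tm (n : ℕ) (k : ℂ) (m : ℕ) : Continuous (tm n k m) := by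
  have := continuous_ja (n + m)
  unfold tm
  fun_prop

lemma continuous_ZZ (n : ℕ) (k : ℂ) : Continuous (ZZ n k) := by
  have := continuous_HC n
  unfold ZZ
  fun_prop

lemma ksq (k : ℂ) : k ^ 2 = (‖k‖ : ℂ) ^ 2 + 2 * I * k.im * k := by
  have h := Complex.mul_conj' k
  have h2 := Complex.sub_conj k
  push_cast at h2
  linear_combination h + k * h2

lemma hasSum_tm (n : ℕ) {k : ℂ} (hk : k ≠ 0) (t : ℝ) :
    HasSum (fun m => tm n k m t) (ZZ n k t) := by
  have hX : (‖k‖ : ℂ) ≠ 0 := by exact_mod_cast (norm_pos_iff.2 hk).ne'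
  have h := (HC_taylor n ((((‖k‖ * t) ^ 2 : ℝ)) : ℂ) (2 * I * k.im * k * t ^ 2)).mul_left
    (((‖k‖ : ℂ) * t) ^ n)
  have e : ((((‖k‖ * t) ^ 2 : ℝ)) : ℂ) + (2 * I * k.im * k * t ^ 2) = (k * t) ^ 2 := by
    push_cast
    rw [mul_pow, mul_pow, ksq k]
    ring
  rw [e] at h
  convert! h using 2 with m
  rw [← HR_cast]
  unfold tm ja
  push_cast
  have e2 : -(2 * I * k.im * k * (t : ℂ) ^ 2) / 2
      = (-(I * (k / ‖k‖)) * k.im * t) * ((‖k‖ : ℂ) * t) := by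
    field_simp
  rw [e2, mul_pow _ ((‖k‖ : ℂ) * t), pow_add]
  ring

lemma norm_base_le {k : ℂ} (hk : k ≠ 0) {t : ℝ} (ht0 : 0 ≤ t) (ht1 : t ≤ 1) :
    ‖-(I * (k / ‖k‖)) * k.im * (t : ℂ)‖ ≤ |k.im| := by
  have hX : ‖k‖ ≠ 0 := (norm_pos_iff.2 hk).ne'
  have h1 : ‖-(I * (k / ‖k‖)) * k.im * (t : ℂ)‖ = |k.im| * t := by
    simp [hX, abs_of_nonneg ht0]
  rw [h1]
  exact mul_le_of_le_one_right (abs_nonneg _) ht1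

lemma norm_tm_le (n : ℕ) {k : ℂ} (hk : k ≠ 0) (m : ℕ) {t : ℝ} (ht0 : 0 ≤ t) (ht1 : t ≤ 1) :
    ‖tm n k m t‖ ≤ |k.im| ^ m / (Nat.factorial m : ℝ) * |ja (n + m) (‖k‖ * t)| := by
  unfold tm
  rw [norm_mul, norm_div, norm_pow, Complex.norm_real, Complex.norm_natCast, Real.norm_eq_abs]
  gcongr
  exact norm_base_le hk ht0 ht1

lemma ja_abs_le (n : ℕ) {s R : ℝ} (hs : 0 ≤ s) (hR : s ≤ R) :
    |ja n s| ≤ R ^ n * Real.exp (R ^ 2) := by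
  unfold ja
  rw [abs_mul, abs_pow, abs_of_nonneg hs]
  have h := HR_abs_le n (s ^ 2)
  have h2 : Real.exp |s ^ 2| ≤ Real.exp (R ^ 2) := by
    rw [abs_of_nonneg (sq_nonneg s)]
    gcongr
  exact mul_le_mul (pow_le_pow_left₀ hs hR n) (h.trans h2) (abs_nonneg _)
    (pow_nonneg (hs.trans hR) _)

/-- uniform bound for partial sums -/
lemma partial_bound (n : ℕ) {k : ℂ} (hk : k ≠ 0) (M : ℕ) {t : ℝ} (ht0 : 0 ≤ t) (ht1 : t ≤ 1) :
    ‖∑ m ∈ Finset.range M, tm n k (m + 1) t‖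
      ≤ (‖k‖ ^ n * Real.exp (‖k‖ ^ 2)) * ∑' m : ℕ, (|k.im| * ‖k‖) ^ (m + 1) / (Nat.factorial (m + 1) : ℝ) := by
  have hs : Summable fun m : ℕ => (|k.im| * ‖k‖) ^ (m + 1) / (Nat.factorial (m + 1) : ℝ) :=
    (summable_nat_add_iff 1).2 (Real.summable_pow_div_factorial (|k.im| * ‖k‖))
  calc ‖∑ m ∈ Finset.range M, tm n k (m + 1) t‖ ≤ ∑ m ∈ Finset.range M, ‖tm n k (m + 1) t‖ :=
        norm_sum_le _ _
    _ ≤ ∑ m ∈ Finset.range M, (‖k‖ ^ n * Real.exp (‖k‖ ^ 2)) *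
          ((|k.im| * ‖k‖) ^ (m + 1) / (Nat.factorial (m + 1) : ℝ)) := by
        apply Finset.sum_le_sum
        intro m _
        refine (norm_tm_le n hk (m + 1) ht0 ht1).trans ?_
        have := ja_abs_le (n + (m + 1)) (s := ‖k‖ * t) (R := ‖k‖) (by positivity)
          (mul_le_of_le_one_right (norm_nonneg _) ht1)
        calc _ ≤ |k.im| ^ (m + 1) / (Nat.factorial (m + 1) : ℝ) *
              (‖k‖ ^ (n + (m + 1)) * Real.exp (‖k‖ ^ 2)) := by gcongr
          _ = _ := by rw [mul_pow, pow_add]; ring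
    _ = (‖k‖ ^ n * Real.exp (‖k‖ ^ 2)) *
          ∑ m ∈ Finset.range M, ((|k.im| * ‖k‖) ^ (m + 1) / (Nat.factorial (m + 1) : ℝ)) := by
        rw [Finset.mul_sum]
    _ ≤ _ := by
        gcongr
        exact hs.sum_le_tsum _ fun _ _ => by positivity

lemma geom_bound (M : ℕ) {r : ℝ} (h0 : 0 ≤ r) (h1 : r ≤ 1 / 2) :
    ∑ m ∈ Finset.range M, r ^ (m + 1) ≤ 2 * r := by
  have hlt : r < 1 := by linarith
  have hs := (summable_geometric_of_lt_one h0 hlt).sum_le_tsum (Finset.range M)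
    fun _ _ => by positivity
  rw [tsum_geometric_of_lt_one h0 hlt] at hs
  have h2 : (1 - r)⁻¹ ≤ 2 := by
    rw [inv_le_comm₀ (by linarith) (by norm_num)]
    linarith
  simp_rw [pow_succ']
  rw [← Finset.mul_sum]
  nlinarith

lemma int_ja (n : ℕ) {X : ℝ} (hX : 0 < X) :
    ∫ t in (0:ℝ)..1, ja n (X * t) ^ 2 = X⁻¹ * II n X := by
  have := intervalIntegral.integral_comp_mul_left (a := 0) (b := 1) (fun s => ja n s ^ 2) hX.ne'
  simpa [II] using this

lemma int_partial (n : ℕ) {k : ℂ} (hk : k ≠ 0) (hy : |k.im| < 1 / 5010) (M : ℕ) :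
    ∫ t in (0:ℝ)..1, ‖∑ m ∈ Finset.range M, tm n k (m + 1) t‖ ^ 2
      ≤ 1 / 50 * ∫ t in (0:ℝ)..1, ja n (‖k‖ * t) ^ 2 := by
  have hX : 0 < ‖k‖ := norm_pos_iff.2 hk
  have cj := fun n => continuous_ja n
  have ct := fun m => continuous_tm n k m
  set c : ℝ := 1 / 5010 with hc
  have hpt : ∀ t ∈ Set.Icc (0:ℝ) 1, ‖∑ m ∈ Finset.range M, tm n k (m + 1) t‖ ^ 2
      ≤ ∑ m ∈ Finset.range M, (2 * c * c ^ (m + 1)) * ja (n + (m + 1)) (‖k‖ * t) ^ 2 := by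
    intro t ht
    have h1 : ‖∑ m ∈ Finset.range M, tm n k (m + 1) t‖
        ≤ ∑ m ∈ Finset.range M, c ^ (m + 1) * |ja (n + (m + 1)) (‖k‖ * t)| := by
      refine (norm_sum_le _ _).trans (Finset.sum_le_sum fun m _ => ?_)
      refine (norm_tm_le n hk (m + 1) ht.1 ht.2).trans ?_
      gcongr
      calc |k.im| ^ (m + 1) / (Nat.factorial (m + 1) : ℝ) ≤ |k.im| ^ (m + 1) / 1 := by
            gcongr
            exact_mod_cast Nat.one_le_iff_ne_zero.2 (Nat.factorial_ne_zero _)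
        _ ≤ c ^ (m + 1) := by rw [div_one]; gcongr
    have h2 : (∑ m ∈ Finset.range M, c ^ (m + 1) * |ja (n + (m + 1)) (‖k‖ * t)|) ^ 2
        ≤ (∑ m ∈ Finset.range M, c ^ (m + 1)) *
          ∑ m ∈ Finset.range M, c ^ (m + 1) * ja (n + (m + 1)) (‖k‖ * t) ^ 2 := by
      apply Finset.sum_sq_le_sum_mul_sum_of_sq_eq_mul
      · intro m _; positivity
      · intro m _; positivity
      · intro m _
        rw [mul_pow, sq_abs]; ring
    have h3 : (∑ m ∈ Finset.range M, c ^ (m + 1)) ≤ 2 * c :=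
      geom_bound M (by norm_num [hc]) (by norm_num [hc])
    calc _ ≤ (∑ m ∈ Finset.range M, c ^ (m + 1) * |ja (n + (m + 1)) (‖k‖ * t)|) ^ 2 := by gcongr
      _ ≤ _ := h2
      _ ≤ 2 * c * ∑ m ∈ Finset.range M, c ^ (m + 1) * ja (n + (m + 1)) (‖k‖ * t) ^ 2 := by
          gcongr
      _ = _ := by rw [Finset.mul_sum]; congr 1; funext m; ring
  calc _ ≤ ∫ t in (0:ℝ)..1, ∑ m ∈ Finset.range M,
        (2 * c * c ^ (m + 1)) * ja (n + (m + 1)) (‖k‖ * t) ^ 2 := by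
        apply intervalIntegral.integral_mono_on zero_le_one
          (Continuous.intervalIntegrable (by fun_prop) _ _)
          (Continuous.intervalIntegrable (by fun_prop) _ _) hpt
    _ = ∑ m ∈ Finset.range M, (2 * c * c ^ (m + 1)) * (‖k‖⁻¹ * II (n + (m + 1)) ‖k‖) := by
        rw [intervalIntegral.integral_finset_sum]
        · congr 1
          funext m
          rw [intervalIntegral.integral_const_mul, int_ja _ hX]
        · intro m _
          exact Continuous.intervalIntegrable (by fun_prop) _ _
    _ ≤ ∑ m ∈ Finset.range M, (2 * c * c ^ (m + 1)) * (‖k‖⁻¹ * (501 ^ (m + 1) * II n ‖k‖)) := by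
        gcongr with m _
        exact II_add_le n (m + 1) hX.le
    _ = 2 * c * (∑ m ∈ Finset.range M, (501 * c) ^ (m + 1)) * (‖k‖⁻¹ * II n ‖k‖) := by
        rw [Finset.mul_sum, Finset.sum_mul]
        congr 1
        funext m
        rw [mul_pow]
        ring
    _ ≤ 2 * c * (2 * (501 * c)) * (‖k‖⁻¹ * II n ‖k‖) := by
        have := II_nonneg n hX.le
        gcongr
        exact geom_bound M (by norm_num [hc]) (by norm_num [hc])
    _ ≤ 1 / 50 * (‖k‖⁻¹ * II n ‖k‖) := by
        have := II_nonneg n hX.le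
        gcongr
        norm_num [hc]
    _ = _ := by rw [int_ja _ hX]

lemma int_diff (n : ℕ) {k : ℂ} (hk : k ≠ 0) (hy : |k.im| < 1 / 5010) :
    ∫ t in (0:ℝ)..1, ‖ZZ n k t - (ja n (‖k‖ * t) : ℂ)‖ ^ 2
      ≤ 1 / 50 * ∫ t in (0:ℝ)..1, ja n (‖k‖ * t) ^ 2 := by
  have ct := fun m => continuous_tm n k m
  refine le_of_tendsto' (f := fun M : ℕ => ∫ t in (0:ℝ)..1, ‖∑ m ∈ Finset.range M, tm n k (m + 1) t‖ ^ 2)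
    (x := Filter.atTop) ?_ (int_partial n hk hy)
  set K := (‖k‖ ^ n * Real.exp (‖k‖ ^ 2)) *
    ∑' m : ℕ, (|k.im| * ‖k‖) ^ (m + 1) / (Nat.factorial (m + 1) : ℝ) with hK
  apply intervalIntegral.tendsto_integral_filter_of_dominated_convergence (fun _ => K ^ 2)
  · refine Filter.Eventually.of_forall fun M => ?_
    exact Continuous.aestronglyMeasurable (by fun_prop)
  · refine Filter.Eventually.of_forall fun M => Filter.Eventually.of_forall fun t ht => ?_
    rw [Set.uIoc_of_le zero_le_one] at ht
    rw [Real.norm_eq_abs, abs_of_nonneg (by positivity)]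
    have := partial_bound n hk M ht.1.le ht.2
    gcongr
  · exact intervalIntegrable_const
  · refine Filter.Eventually.of_forall fun t _ => ?_
    have h := hasSum_tm n hk t
    have h2 := ((hasSum_nat_add_iff' 1).2 h).tendsto_sum_nat
    have e : ∑ i ∈ Finset.range 1, tm n k i t = (ja n (‖k‖ * t) : ℂ) := by
      simp [tm]
    rw [e] at h2
    exact (h2.norm).pow 2

lemma int_pos (n : ℕ) {k : ℂ} (hk : k ≠ 0) : 0 < ∫ t in (0:ℝ)..1, ja n (‖k‖ * t) ^ 2 := by
  have hX : 0 < ‖k‖ := norm_pos_iff.2 hk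
  have cj := continuous_ja n
  have hpos : ∀ᶠ s in nhds (0:ℝ), 0 < HR n ((‖k‖ * s) ^ 2) := by
    have hc : ContinuousAt (fun s : ℝ => HR n ((‖k‖ * s) ^ 2)) 0 := by
      have := continuous_HR n
      exact Continuous.continuousAt (by fun_prop)
    apply hc.eventually_const_lt
    simpa using HR_zero_pos n
  obtain ⟨ε, hε, hb⟩ := Metric.eventually_nhds_iff.1 hpos
  refine intervalIntegral.integral_pos zero_lt_one (Continuous.continuousOn (by fun_prop))
    (fun _ _ => sq_nonneg _) ⟨min (ε / 2) 1, ⟨by positivity, min_le_right _ _⟩, ?_⟩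
  have hm : 0 < min (ε / 2) 1 := by positivity
  have := hb (y := min (ε / 2) 1) (by
    rw [Real.dist_eq, sub_zero, abs_of_pos hm]
    exact (min_le_left _ _).trans_lt (by linarith))
  unfold ja
  positivity

lemma re_bound (w A : ℝ) (Z : ℂ) (hw1 : 1 ≤ w) (hw4 : w ≤ 4) :
    1 / 2 * A ^ 2 - 12 * ‖Z - (A : ℂ)‖ ^ 2 ≤ ((w : ℂ) * Z ^ 2).re := by
  rw [Complex.sq_norm, Complex.normSq_apply, Complex.re_ofReal_mul, sq Z, Complex.mul_re]
  simp only [Complex.sub_re, Complex.sub_im, Complex.ofReal_re, Complex.ofReal_im, sub_zero]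
  generalize Z.re = x
  generalize Z.im = y
  obtain ⟨d, rfl⟩ : ∃ d, x = A + d := ⟨x - A, by ring⟩
  have h1 : A ^ 2 / 2 - 2 * (d ^ 2 + y ^ 2) ≤ (A + d) * (A + d) - y * y := by
    nlinarith [sq_nonneg (A + 2 * d), sq_nonneg d, sq_nonneg y]
  have h2 := mul_le_mul_of_nonneg_left h1 (by linarith : (0:ℝ) ≤ w)
  nlinarith [mul_nonneg (sub_nonneg.2 hw1) (sq_nonneg A),
    mul_nonneg (sub_nonneg.2 hw4) (add_nonneg (sq_nonneg d) (sq_nonneg y)), sq_nonneg d, sq_nonneg y]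

lemma int_ZZ_ne (n : ℕ) {k : ℂ} (hk : k ≠ 0) (hy : |k.im| < 1 / 5010) :
    ∫ t in (0:ℝ)..1, ((t : ℂ) + 1) ^ 2 * (ZZ n k t) ^ 2 ≠ 0 := by
  intro h0
  have cj := continuous_ja n
  have cZ := continuous_ZZ n k
  have h1 := int_diff n hk hy
  have h2 := int_pos n hk
  have hre : ∫ t in (0:ℝ)..1, (((t : ℂ) + 1) ^ 2 * (ZZ n k t) ^ 2).re = 0 := by
    have := Complex.reCLM.intervalIntegral_comp_comm (μ := volume) (a := 0) (b := 1)
      (f := fun t : ℝ => ((t : ℂ) + 1) ^ 2 * (ZZ n k t) ^ 2)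
      (Continuous.intervalIntegrable (by fun_prop) _ _)
    rw [h0] at this
    simpa using this
  have h3 : ∫ t in (0:ℝ)..1, (1 / 2 * ja n (‖k‖ * t) ^ 2 - 12 * ‖ZZ n k t - (ja n (‖k‖ * t) : ℂ)‖ ^ 2)
      ≤ ∫ t in (0:ℝ)..1, (((t : ℂ) + 1) ^ 2 * (ZZ n k t) ^ 2).re := by
    apply intervalIntegral.integral_mono_on zero_le_one
      (Continuous.intervalIntegrable (by fun_prop) _ _)
      (Continuous.intervalIntegrable (by fun_prop) _ _)
    intro t ht
    have := re_bound ((t + 1) ^ 2) (ja n (‖k‖ * t)) (ZZ n k t) (by nlinarith [ht.1])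
      (by nlinarith [ht.1, ht.2])
    push_cast at this
    exact this
  rw [hre, intervalIntegral.integral_sub (Continuous.intervalIntegrable (by fun_prop) _ _)
    (Continuous.intervalIntegrable (by fun_prop) _ _), intervalIntegral.integral_const_mul,
    intervalIntegral.integral_const_mul] at h3
  linarith

theorem stmt_9 :
    ∃ c : ℝ, 0 < c ∧ ∀ n : ℕ, ∀ k : ℂ, k ≠ 0 → |k.im| < c → BornB3 n k ≠ 0 := by
  refine ⟨1 / 5010, by norm_num, fun n k hk hy h => int_ZZ_ne n hk hy ?_⟩
  have hX : (‖k‖ : ℂ) ≠ 0 := by exact_mod_cast (norm_pos_iff.2 hk).ne'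
  have e : BornB3 n k = (k / ‖k‖) ^ (2 * n) *
      ∫ t in (0:ℝ)..1, ((t : ℂ) + 1) ^ 2 * (ZZ n k t) ^ 2 := by
    unfold BornB3
    rw [← intervalIntegral.integral_const_mul]
    congr 1
    funext t
    rw [sphBesselJ_eq]
    unfold ZZ
    have : k * t = (k / ‖k‖) * (‖k‖ * t) := by field_simp
    rw [show (k * (t : ℂ)) ^ n = ((k / ‖k‖) * (‖k‖ * t)) ^ n by rw [← this], mul_pow (k / _), pow_mul']
    ring
  rw [e] at h
  rcases mul_eq_zero.1 h with h | h
  · exact absurd h (pow_ne_zero _ (div_ne_zero hk hX))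
  · exact h
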